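/- Consider any trajectory of the opinion dynamics system (2.1), and suppose that (a) no nonempty subset of V₂ is a cohesive agent set, and (b) there exists a weak cohesive group set Q* ⊆ {1,…,l} consisting only of opinionated agents (a_{kj} = 0 for every k ∈ Q* and every j ∈ V₂). Then: (i) If there exists T ≥ 0 such that t ↦ min_{i∈V} x_i(t) is monotonically non-decreasing on t ≥ T, then for every i ∈ V₂ and every t ≥ T + n₂: x_i(t) ≥ min { x_j(s) : j ∈ V₁, t − n₂ ≤ s ≤ t − 1 }. (ii) If there exists T ≥ 0 such that t ↦ max_{i∈V} x_i(t) is monotonically non-increasing on t ≥ T, then for every i ∈ V₂ and every t ≥ T + n₂: x_i(t) ≤ max { x_j(s) : j ∈ V₁, t − n₂ ≤ s ≤ t − 1 }. -/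

import Mathlib

open Filter Topology

def IsWeightVec {n : ℕ} (w : Fin n → ℝ) : Prop :=
  (∀ j, 0 ≤ w j) ∧ (∑ j, w j) = 1

def IsWMedian {n : ℕ} (w : Fin n → ℝ) (x : Fin n → ℝ) (a : ℝ) : Prop :=
  (∑ j ∈ Finset.univ.filter (fun j => x j < a), w j) ≤ 1 / 2 ∧
  (∑ j ∈ Finset.univ.filter (fun j => a < x j), w j) ≤ 1 / 2

def RowStochastic {m n : ℕ} (A : Matrix (Fin m) (Fin n) ℝ) : Prop :=
  ∀ i, IsWeightVec (A i)

/-- A trajectory of the opinion dynamics system (2.1): at each time step each agent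
mixes its bias `u` (with weight `lam i`) with an external opinion built from some
weighted median of the agent opinions and some weighted median of the environmental
opinions `A.mulVec (x t)`. -/
def IsTrajectory {n l : ℕ} (lam γ : Fin n → ℝ) (u : ℝ)
    (W : Matrix (Fin n) (Fin n) ℝ) (M : Matrix (Fin n) (Fin l) ℝ)
    (A : Matrix (Fin l) (Fin n) ℝ) (x : ℕ → Fin n → ℝ) : Prop :=
  ∀ t i, ∃ m mhat : ℝ,
    IsWMedian (W i) (x t) m ∧
    IsWMedian (M i) (A.mulVec (x t)) mhat ∧
    x (t + 1) i = lam i * u + (1 - lam i) * ((1 - γ i) * m + γ i * mhat)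

/-- A nonempty `P ⊆ V` is a cohesive agent set if every member places at least
half of its total weight inside `P`. -/
def CohesiveAgentSet {n : ℕ} (W : Matrix (Fin n) (Fin n) ℝ) (P : Finset (Fin n)) : Prop :=
  P.Nonempty ∧ ∀ i ∈ P, 1 / 2 ≤ ∑ j ∈ P, W i j

/-- A nonempty `Q ⊆ {1,…,l}` is a weak cohesive group set if every agent places more
than half of its environmental weight on the simplices in `Q`. -/
def WeakCohesiveGroupSet {n l : ℕ} (M : Matrix (Fin n) (Fin l) ℝ)
    (Q : Finset (Fin l)) : Prop :=
  Q.Nonempty ∧ ∀ i, 1 / 2 < ∑ k ∈ Q, M i k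

theorem IsWMedian.le_of_half_lt {n : ℕ} {w x : Fin n → ℝ} {a b : ℝ} (ha : IsWMedian w x a)
    (hw : ∀ j, 0 ≤ w j) {S : Finset (Fin n)} (hS : 1 / 2 < ∑ j ∈ S, w j)
    (hb : ∀ j ∈ S, b ≤ x j) : b ≤ a := by
  by_contra! hab
  have hsub : S ⊆ Finset.univ.filter (fun j => a < x j) := fun j hj => by
    simpa using hab.trans_le (hb j hj)
  linarith [ha.2, Finset.sum_le_sum_of_subset_of_nonneg hsub fun j _ _ => hw j]

theorem IsWMedian.neg {n : ℕ} {w x : Fin n → ℝ} {a : ℝ} (ha : IsWMedian w x a) :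
    IsWMedian w (-x) (-a) := by
  simpa [IsWMedian, and_comm] using ha

theorem IsTrajectory.neg {n l : ℕ} {lam γ : Fin n → ℝ} {u : ℝ}
    {W : Matrix (Fin n) (Fin n) ℝ} {M : Matrix (Fin n) (Fin l) ℝ}
    {A : Matrix (Fin l) (Fin n) ℝ} {x : ℕ → Fin n → ℝ} (hx : IsTrajectory lam γ u W M A x) :
    IsTrajectory lam γ (-u) W M A (-x) := by
  intro t i
  obtain ⟨m, mhat, hm, hmhat, hxt⟩ := hx t i
  refine ⟨-m, -mhat, hm.neg, ?_, ?_⟩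
  · simpa [Matrix.mulVec_neg] using hmhat.neg
  · simp only [Pi.neg_apply, hxt]
    ring

theorem IsWeightVec.le_dotProduct {n : ℕ} {w x : Fin n → ℝ} {b : ℝ} (hw : IsWeightVec w)
    (hb : ∀ j, w j ≠ 0 → b ≤ x j) : b ≤ w ⬝ᵥ x := by
  calc b = ∑ j, w j * b := by rw [← Finset.sum_mul, hw.2, one_mul]
    _ ≤ ∑ j, w j * x j := Finset.sum_le_sum fun j _ => by
      rcases eq_or_ne (w j) 0 with h | h
      · simp [h]
      · exact mul_le_mul_of_nonneg_left (hb j h) (hw.1 j)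

/-- An unopinionated agent stays above any common lower bound `b` on the opinionated agents'
opinions, provided the agents with opinion below `b` carry less than half of its weight. -/
theorem IsTrajectory.le_succ_of_sum_lt_half {n l : ℕ} {lam γ : Fin n → ℝ} {u : ℝ}
    {W : Matrix (Fin n) (Fin n) ℝ} {M : Matrix (Fin n) (Fin l) ℝ}
    {A : Matrix (Fin l) (Fin n) ℝ} {x : ℕ → Fin n → ℝ} (hx : IsTrajectory lam γ u W M A x)
    (hγ : ∀ i, 0 ≤ γ i ∧ γ i ≤ 1)
    (hW : RowStochastic W) (hM : RowStochastic M) (hA : RowStochastic A)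
    {V₂ R : Finset (Fin n)} {Q : Finset (Fin l)} (hQ : WeakCohesiveGroupSet M Q)
    (hAQ : ∀ k ∈ Q, ∀ j ∈ V₂, A k j = 0) {b : ℝ} {t : ℕ} {i : Fin n} (hi : lam i = 0)
    (hR : ∑ j ∈ R, W i j < 1 / 2) (hRb : ∀ j ∉ R, b ≤ x t j) (hV : ∀ j ∉ V₂, b ≤ x t j) :
    b ≤ x (t + 1) i := by
  obtain ⟨m, mhat, hm, hmhat, hxt⟩ := hx t i
  have hbm : b ≤ m := by
    refine hm.le_of_half_lt (hW i).1 (S := Rᶜ) ?_ fun j hj => hRb j (by simpa using hj)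
    linarith [Finset.sum_add_sum_compl R (W i), (hW i).2]
  have hbmhat : b ≤ mhat :=
    hmhat.le_of_half_lt (hM i).1 (hQ.2 i) fun k hk => (hA k).le_dotProduct fun j hj =>
      hV j fun hj₂ => hj (hAQ k hk j hj₂)
  rw [hxt, hi]
  nlinarith [mul_le_mul_of_nonneg_left hbm (sub_nonneg.2 (hγ i).2),
    mul_le_mul_of_nonneg_left hbmhat (hγ i).1]

/-- A lower bound on the opinionated agents over a window of length `V₂.card` passes to the
unopinionated agents at the end of the window. -/
theorem IsTrajectory.le_of_forall_opinionated {n l : ℕ} {lam γ : Fin n → ℝ} {u : ℝ}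
    {W : Matrix (Fin n) (Fin n) ℝ} {M : Matrix (Fin n) (Fin l) ℝ}
    {A : Matrix (Fin l) (Fin n) ℝ} {x : ℕ → Fin n → ℝ} (hx : IsTrajectory lam γ u W M A x)
    (hγ : ∀ i, 0 ≤ γ i ∧ γ i ≤ 1)
    (hW : RowStochastic W) (hM : RowStochastic M) (hA : RowStochastic A)
    {V₂ : Finset (Fin n)} (hlam : ∀ i ∈ V₂, lam i = 0)
    (hnoco : ∀ P : Finset (Fin n), P ⊆ V₂ → ¬ CohesiveAgentSet W P)
    {Q : Finset (Fin l)} (hQ : WeakCohesiveGroupSet M Q)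
    (hAQ : ∀ k ∈ Q, ∀ j ∈ V₂, A k j = 0) {b : ℝ} {t : ℕ} (ht : V₂.card ≤ t)
    (hb : ∀ j ∉ V₂, ∀ s, t - V₂.card ≤ s → s < t → b ≤ x s j) {i : Fin n} (hi : i ∈ V₂) :
    b ≤ x t i := by
  have key : ∀ k, ∃ R ⊆ V₂, R.card ≤ V₂.card - k ∧
      ∀ s, t - V₂.card + k ≤ s → s ≤ t → ∀ j ∈ V₂, j ∉ R → b ≤ x s j := by
    intro k
    induction k with
    | zero => exact ⟨V₂, subset_rfl, le_rfl, fun s _ _ j hj hj' => absurd hj hj'⟩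
    | succ k ih =>
      obtain ⟨R, hRV, hcard, hR⟩ := ih
      rcases R.eq_empty_or_nonempty with rfl | hne
      · exact ⟨∅, hRV, by simp, fun s hs => hR s (by omega)⟩
      obtain ⟨p, hp, hpR⟩ : ∃ p ∈ R, ∑ j ∈ R, W p j < 1 / 2 := by
        by_contra! h
        exact hnoco R hRV ⟨hne, h⟩
      refine ⟨R.erase p, (R.erase_subset p).trans hRV, ?_, ?_⟩
      · rw [Finset.card_erase_of_mem hp]
        omega
      · intro s hs hst j hj hjR
        by_cases hjp : j = p
        · subst hjp
          obtain ⟨r, rfl⟩ : ∃ r, s = r + 1 := ⟨s - 1, by omega⟩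
          have hV : ∀ q ∉ V₂, b ≤ x r q := fun q hq => hb q hq r (by omega) (by omega)
          refine hx.le_succ_of_sum_lt_half hγ hW hM hA hQ hAQ (hlam j hj) hpR (fun q hq => ?_) hV
          by_cases hq₂ : q ∈ V₂
          · exact hR r (by omega) (by omega) q hq₂ hq
          · exact hV q hq₂
        · exact hR s (by omega) hst j hj fun h => hjR (Finset.mem_erase.2 ⟨hjp, h⟩)
  obtain ⟨R, -, hcard, hR⟩ := key V₂.card
  obtain rfl : R = ∅ := by simpa using hcard
  exact hR t (by omega) le_rfl i hi (by simp)

theorem finite_windowValues {n : ℕ} (V : Finset (Fin n)) (x : ℕ → Fin n → ℝ) (a b : ℕ) :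
    {y : ℝ | ∃ j ∈ V, ∃ s, a ≤ s ∧ s ≤ b ∧ y = x s j}.Finite := by
  refine ((Finset.Icc a b ×ˢ V).image fun p => x p.1 p.2).finite_toSet.subset ?_
  rintro y ⟨j, hj, s, hs, hs', rfl⟩
  simp only [Finset.coe_image, Set.mem_image, Finset.mem_coe, Finset.mem_product, Finset.mem_Icc]
  exact ⟨(s, j), ⟨⟨hs, hs'⟩, hj⟩, rfl⟩

/-- Lemma 3.7: under hypotheses (a)–(b), if the minimum (resp. maximum) opinion is
eventually monotone, then from time $T + n_2$ on each unopinionated agent's opinion is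
bounded below (resp. above) by the min (resp. max) of the opinionated agents' opinions
over the last $n_2$ time steps. -/
theorem stmt10 {n l : ℕ} [NeZero n]
    (V₁ V₂ : Finset (Fin n)) (hV : V₂ = V₁ᶜ)
    (lam γ : Fin n → ℝ) (u : ℝ)
    (hlam₁ : ∀ i ∈ V₁, 0 < lam i ∧ lam i ≤ 1)
    (hlam₂ : ∀ i ∈ V₂, lam i = 0)
    (hγ : ∀ i, 0 ≤ γ i ∧ γ i ≤ 1)
    (W : Matrix (Fin n) (Fin n) ℝ) (M : Matrix (Fin n) (Fin l) ℝ)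
    (A : Matrix (Fin l) (Fin n) ℝ)
    (hW : RowStochastic W) (hM : RowStochastic M) (hA : RowStochastic A)
    (hnoco : ∀ P : Finset (Fin n), P ⊆ V₂ → ¬ CohesiveAgentSet W P)
    (hweak : ∃ Q : Finset (Fin l), WeakCohesiveGroupSet M Q ∧ ∀ k ∈ Q, ∀ j ∈ V₂, A k j = 0)
    (x : ℕ → Fin n → ℝ) (htraj : IsTrajectory lam γ u W M A x) :
    (∀ T : ℕ, (∀ s t, T ≤ s → s ≤ t → (⨅ i, x s i) ≤ ⨅ i, x t i) →
      ∀ i ∈ V₂, ∀ t, T + V₂.card ≤ t →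
        sInf {y : ℝ | ∃ j ∈ V₁, ∃ s, t - V₂.card ≤ s ∧ s ≤ t - 1 ∧ y = x s j} ≤ x t i) ∧
    (∀ T : ℕ, (∀ s t, T ≤ s → s ≤ t → (⨆ i, x t i) ≤ ⨆ i, x s i) →
      ∀ i ∈ V₂, ∀ t, T + V₂.card ≤ t →
        x t i ≤ sSup {y : ℝ | ∃ j ∈ V₁, ∃ s, t - V₂.card ≤ s ∧ s ≤ t - 1 ∧ y = x s j}) := by
  subst hV
  obtain ⟨Q, hQ, hAQ⟩ := hweak
  refine ⟨fun T _ i hi t ht => ?_, fun T _ i hi t ht => ?_⟩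
  · refine htraj.le_of_forall_opinionated hγ hW hM hA hlam₂ hnoco hQ hAQ
      (by omega) (fun j hj s hs hst => ?_) hi
    exact csInf_le (finite_windowValues V₁ x _ _).bddBelow
      ⟨j, by simpa using hj, s, hs, by omega, rfl⟩
  · refine neg_le_neg_iff.1 (htraj.neg.le_of_forall_opinionated hγ hW hM hA hlam₂ hnoco hQ hAQ
      (by omega) (fun j hj s hs hst => ?_) hi)
    exact neg_le_neg (le_csSup (finite_windowValues V₁ x _ _).bddAbove
      ⟨j, by simpa using hj, s, hs, by omega, rfl⟩)
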